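/- arXiv:2411.15810 — 2 statements merged into one kernel-verified Lean document; each statement's English description precedes it below -/
import Mathlib

section
/- Let R > 0 and let l ≥ 1 and m be integers with 0 ≤ m < l. Set s = (2m+1)/(4l). Then there exists a constant c > 0, depending only on R and l, such that for every function φ : ℝ → ℝ which is l times continuously differentiable on [0,R] one has sup_{x ∈ [0,R]} |φ^{(m)}(x)| ≤ c (∫₀^R (φ^{(l)}(x))² dx)^{s} (∫₀^R φ(x)² dx)^{(1−2s)/2} + c (∫₀^R φ(x)² dx)^{1/2}. -/
open MeasureTheory Set

/-- A polynomial with vanishing `L²` norm on `(0,1)` has zero coefficients. -/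
theorem coeff_eq_zero_of_integral_sq_eq_zero {l : ℕ} (a : Fin l → ℝ)
    (h : ∫ t in (0:ℝ)..1, (∑ j, a j * t ^ (j : ℕ)) ^ 2 = 0) : a = 0 := by
  have hzero : ∀ t ∈ Icc (0:ℝ) 1, ∑ j, a j * t ^ (j : ℕ) = 0 := by
    by_contra! hne
    obtain ⟨t, ht, hne⟩ := hne
    refine (intervalIntegral.integral_pos (f := fun t ↦ (∑ j, a j * t ^ (j : ℕ)) ^ 2)
      zero_lt_one (by fun_prop) (fun _ _ ↦ sq_nonneg _) ⟨t, ht, by positivity⟩).ne' h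
  have hp : (∑ j, Polynomial.C (a j) * Polynomial.X ^ (j : ℕ) : Polynomial ℝ) = 0 := by
    refine Polynomial.eq_zero_of_infinite_isRoot _ ((Icc_infinite zero_lt_one).mono fun t ht ↦ ?_)
    simpa [Polynomial.IsRoot, Polynomial.eval_finsetSum] using hzero t ht
  funext i
  simpa [Polynomial.finsetSum_coeff, Polynomial.coeff_C_mul, Polynomial.coeff_X_pow,
    Fin.val_inj] using congrArg (Polynomial.coeff · (i : ℕ)) hp

/-- The monomials of degree `< l` on `(0,1)` admit a continuous dual family with respect to the `L²`
pairing. -/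
theorem exists_continuous_dual_monomial {l : ℕ} (m : Fin l) :
    ∃ q : ℝ → ℝ, Continuous q ∧
      ∀ k : Fin l, ∫ t in (0:ℝ)..1, t ^ (k : ℕ) * q t = if k = m then 1 else 0 := by
  let H : Matrix (Fin l) (Fin l) ℝ := .of fun k j ↦ ∫ t in (0:ℝ)..1, t ^ (k : ℕ) * t ^ (j : ℕ)
  have hH : ∀ a k, H.mulVec a k = ∫ t in (0:ℝ)..1, t ^ (k : ℕ) * ∑ j, a j * t ^ (j : ℕ) := by
    intro a k
    change ∑ j, H k j * a j = _
    simp_rw [Finset.mul_sum]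
    rw [intervalIntegral.integral_finsetSum
      fun j _ ↦ (Continuous.intervalIntegrable (by fun_prop) _ _)]
    refine Finset.sum_congr rfl fun j _ ↦ ?_
    change (∫ t in (0:ℝ)..1, t ^ (k : ℕ) * t ^ (j : ℕ)) * a j = _
    rw [← intervalIntegral.integral_mul_const]
    congr 1 with t
    ring
  have hinj : Function.Injective H.mulVecLin := by
    rw [← LinearMap.ker_eq_bot, LinearMap.ker_eq_bot']
    intro a ha
    refine coeff_eq_zero_of_integral_sq_eq_zero a ?_
    have h0 : ∑ k, a k * H.mulVec a k = 0 := by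
      simp [show H.mulVec a = 0 from ha]
    simp_rw [hH, ← intervalIntegral.integral_const_mul] at h0
    rw [← intervalIntegral.integral_finsetSum
      fun j _ ↦ Continuous.intervalIntegrable (by fun_prop) _ _] at h0
    rw [← h0]
    congr 1 with t
    rw [sq, Finset.sum_mul]
    exact Finset.sum_congr rfl fun j _ ↦ by ring
  obtain ⟨a, ha⟩ := LinearMap.injective_iff_surjective.1 hinj (Pi.single m 1)
  refine ⟨fun t ↦ ∑ j, a j * t ^ (j : ℕ), by fun_prop, fun k ↦ ?_⟩
  rw [← hH, ← Matrix.mulVecLin_apply, ha, Pi.single_apply]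

/-- The Cauchy–Schwarz inequality against the constant function `1`. -/
theorem integral_abs_le_sqrt_mul_sqrt {g : ℝ → ℝ} {a b : ℝ} (hab : a ≤ b)
    (hg : ContinuousOn g (Icc a b)) :
    ∫ t in a..b, |g t| ≤ √(b - a) * √(∫ t in a..b, g t ^ 2) := by
  rcases hab.eq_or_lt with rfl | hlt
  · simp
  rw [← Real.sqrt_mul (sub_nonneg.2 hab)]
  refine Real.le_sqrt_of_sq_le ?_
  rw [← uIcc_of_le hab] at hg
  have h1 : IntervalIntegrable (fun t ↦ |g t|) volume a b := hg.abs.intervalIntegrable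
  have h2 : IntervalIntegrable (fun t ↦ g t ^ 2) volume a b := (hg.pow 2).intervalIntegrable
  set I := ∫ t in a..b, |g t|
  set L := b - a with hL
  have hLpos : 0 < L := sub_pos.2 hlt
  have key : ∫ t in a..b, (L * |g t| - I) ^ 2 = L * (L * (∫ t in a..b, g t ^ 2) - I ^ 2) := by
    have : ∀ t, (L * |g t| - I) ^ 2 = L ^ 2 * g t ^ 2 - 2 * L * I * |g t| + I ^ 2 := fun t ↦ by
      rw [← sq_abs (g t)]; ring
    simp_rw [this]
    rw [intervalIntegral.integral_add ((h2.const_mul _).sub (h1.const_mul _)) (by simp),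
      intervalIntegral.integral_sub (h2.const_mul _) (h1.const_mul _),
      intervalIntegral.integral_const_mul, intervalIntegral.integral_const_mul,
      intervalIntegral.integral_const, ← hL, smul_eq_mul]
    ring
  have hnn : 0 ≤ ∫ t in a..b, (L * |g t| - I) ^ 2 :=
    intervalIntegral.integral_nonneg hab fun _ _ ↦ sq_nonneg _
  rw [key] at hnn
  linarith [nonneg_of_mul_nonneg_right hnn hLpos]

theorem abs_integral_abs_le_of_mem_Icc {g : ℝ → ℝ} {a b u v : ℝ}
    (hg : ContinuousOn g (Icc a b)) (hu : u ∈ Icc a b) (hv : v ∈ Icc a b) :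
   |∫ t in u..v, (|g t|)| ≤ √|v - u| * √(∫ t in a..b, g t ^ 2) := by
  wlog huv : u ≤ v generalizing u v
  · rw [intervalIntegral.integral_symm, abs_neg, abs_sub_comm]
    exact this hv hu (le_of_not_ge huv)
  have hsub : Icc u v ⊆ Icc a b := Icc_subset_Icc hu.1 hv.2
  rw [abs_of_nonneg (intervalIntegral.integral_nonneg huv fun _ _ ↦ abs_nonneg _),
    abs_of_nonneg (sub_nonneg.2 huv)]
  refine (integral_abs_le_sqrt_mul_sqrt huv (hg.mono hsub)).trans ?_
  gcongr
  refine intervalIntegral.integral_mono_interval hu.1 huv hv.2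
    (Filter.Eventually.of_forall fun _ ↦ sq_nonneg _) ?_
  exact ((uIcc_of_le (hu.1.trans hu.2)).symm ▸ hg.pow 2 :
    ContinuousOn (fun t ↦ g t ^ 2) (uIcc a b)).intervalIntegrable

/-- The Taylor remainder is controlled by the `L²` norm of the derivative of order `n + 1`. -/
theorem abs_sub_taylorWithinEval_le {f : ℝ → ℝ} {a b x y : ℝ} {n : ℕ} (hab : a < b)
    (hf : ContDiffOn ℝ (n + 1 : ℕ) f (Icc a b)) (hx : x ∈ Icc a b) (hy : y ∈ Icc a b) :
    |f y - taylorWithinEval f n (Icc a b) x y| ≤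
      |y - x| ^ n * (√|y - x| * √(∫ t in a..b, iteratedDerivWithin (n + 1) f (Icc a b) t ^ 2)) := by
  have hu := uniqueDiffOn_Icc hab
  have hsub : uIcc x y ⊆ Icc a b := ordConnected_Icc.uIcc_subset hx hy
  have hg : ContinuousOn (iteratedDerivWithin (n + 1) f (Icc a b)) (Icc a b) :=
    hf.continuousOn_iteratedDerivWithin le_rfl hu
  have hf' : ContDiffOn ℝ n f (Icc a b) := hf.of_le (by exact_mod_cast n.le_succ)
  have hd : DifferentiableOn ℝ (iteratedDerivWithin n f (Icc a b)) (Icc a b) :=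
    hf.differentiableOn_iteratedDerivWithin (by exact_mod_cast n.lt_succ_self) hu
  have hI : IntervalIntegrable (fun t ↦ ((n.factorial : ℝ)⁻¹ * (y - t) ^ n) •
      iteratedDerivWithin (n + 1) f (Icc a b) t) volume x y :=
    (ContinuousOn.smul (f := fun t ↦ (n.factorial : ℝ)⁻¹ * (y - t) ^ n) (by fun_prop)
      (hg.mono hsub)).intervalIntegrable
  have hftc := intervalIntegral.integral_eq_sub_of_hasDeriv_right
    ((continuousOn_taylorWithinEval (x := y) hu hf').mono hsub)
    (fun t ht ↦ (taylorWithinEval_hasDerivAt_Ioo y hab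
      ⟨(le_min hx.1 hy.1).trans_lt ht.1, ht.2.trans_le (max_le hx.2 hy.2)⟩ hf'
      (hd.mono Ioo_subset_Icc_self)).hasDerivWithinAt) hI
  rw [taylorWithinEval_self] at hftc
  rw [← hftc]
  have hbd : IntervalIntegrable
      (fun t ↦ |y - x| ^ n * |iteratedDerivWithin (n + 1) f (Icc a b) t|) volume x y :=
    (ContinuousOn.mul continuousOn_const (hg.mono hsub).abs).intervalIntegrable
  rw [← Real.norm_eq_abs]
  refine (intervalIntegral.norm_integral_le_abs_of_norm_le (ae_restrict_of_forall_mem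
    measurableSet_uIoc fun t ht ↦ ?_) hbd).trans ?_
  · have hfac : ((n.factorial : ℝ))⁻¹ ≤ 1 :=
      inv_le_one_of_one_le₀ (by exact_mod_cast n.factorial_pos)
    have hty : |y - t| ≤ |y - x| := abs_sub_right_of_mem_uIcc (uIoc_subset_uIcc ht)
    rw [norm_smul, norm_mul, norm_pow, Real.norm_eq_abs, Real.norm_eq_abs, Real.norm_eq_abs,
      abs_of_nonneg (by positivity : (0:ℝ) ≤ (n.factorial : ℝ)⁻¹)]
    gcongr
    calc _ ≤ 1 * |y - t| ^ n := by gcongr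
      _ ≤ _ := by rw [one_mul]; gcongr
  · rw [intervalIntegral.integral_const_mul, abs_mul, abs_of_nonneg (by positivity)]
    gcongr
    exact abs_integral_abs_le_of_mem_Icc hg hx hy

/-- Pointwise bound for an intermediate derivative on the segment between `x` and `x + h`. -/
theorem exists_abs_iteratedDerivWithin_mul_pow_le {n m : ℕ} (hm : m ≤ n) :
    ∃ K : ℝ, 0 ≤ K ∧ ∀ (f : ℝ → ℝ) (a b x h : ℝ), a < b →
      ContDiffOn ℝ (n + 1 : ℕ) f (Icc a b) → x ∈ Icc a b → x + h ∈ Icc a b → h ≠ 0 →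
      |iteratedDerivWithin m f (Icc a b) x| * |h| ^ m ≤
        K * ((√|h|)⁻¹ * √(∫ t in a..b, f t ^ 2) + |h| ^ n *
          (√|h| * √(∫ t in a..b, iteratedDerivWithin (n + 1) f (Icc a b) t ^ 2))) := by
  obtain ⟨q, hq, hdual⟩ :=
    exists_continuous_dual_monomial (⟨m, Nat.lt_succ_of_le hm⟩ : Fin (n + 1))
  obtain ⟨C, hC⟩ := isCompact_Icc.exists_bound_of_continuousOn (s := Icc (0:ℝ) 1) hq.continuousOn
  have hC0 : 0 ≤ C := (norm_nonneg _).trans (hC 0 (by simp))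
  refine ⟨m.factorial * C, by positivity, fun f a b x h hab hf hx hxh hh ↦ ?_⟩
  set A := √(∫ t in a..b, iteratedDerivWithin (n + 1) f (Icc a b) t ^ 2)
  set B := √(∫ t in a..b, f t ^ 2)
  set D := fun k ↦ iteratedDerivWithin k f (Icc a b) x with hD
  have hseg : ∀ t ∈ Icc (0:ℝ) 1, x + h * t ∈ Icc a b := fun t ht ↦ by
    have := (convex_Icc a b).add_smul_mem hx hxh ht
    rwa [smul_eq_mul, mul_comm] at this
  have hP : ∀ t, taylorWithinEval f n (Icc a b) x (x + h * t) =
      ∑ k : Fin (n + 1), ((k : ℕ).factorial : ℝ)⁻¹ * h ^ (k : ℕ) * D k * t ^ (k : ℕ) := fun t ↦ by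
    rw [taylor_within_apply, ← Fin.sum_univ_eq_sum_range (fun k ↦
      ((k.factorial : ℝ)⁻¹ * (x + h * t - x) ^ k) • iteratedDerivWithin k f (Icc a b) x)]
    refine Finset.sum_congr rfl fun k _ ↦ ?_
    rw [add_sub_cancel_left, mul_pow, smul_eq_mul]
    ring
  have hint : ∫ t in (0:ℝ)..1, taylorWithinEval f n (Icc a b) x (x + h * t) * q t =
      (m.factorial : ℝ)⁻¹ * h ^ m * D m := by
    simp_rw [hP, Finset.sum_mul, mul_assoc _ (_ ^ _) (q _)]
    rw [intervalIntegral.integral_finsetSum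
      fun k _ ↦ Continuous.intervalIntegrable (by fun_prop) _ _]
    simp_rw [intervalIntegral.integral_const_mul, hdual]
    simp
  have hfc : ContinuousOn (fun t ↦ |f (x + h * t)|) (Icc 0 1) :=
    (hf.continuousOn.comp (by fun_prop) hseg).abs
  have hfi : IntervalIntegrable (fun t ↦ |f (x + h * t)|) volume 0 1 :=
    (uIcc_of_le (zero_le_one' ℝ) ▸ hfc : ContinuousOn _ (uIcc (0:ℝ) 1)).intervalIntegrable
  have hh' : 0 < |h| := abs_pos.2 hh
  have hL1 : ∫ t in (0:ℝ)..1, |f (x + h * t)| ≤ (√|h|)⁻¹ * B := by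
    rw [intervalIntegral.integral_comp_add_mul (fun t ↦ |f t|) hh]
    refine (le_abs_self _).trans ?_
    rw [smul_eq_mul, abs_mul, abs_inv]
    have := abs_integral_abs_le_of_mem_Icc hf.continuousOn hx hxh
    rw [add_sub_cancel_left] at this
    simp only [mul_zero, mul_one, add_zero]
    calc _ ≤ |h|⁻¹ * (√|h| * B) := by gcongr
      _ = (√|h|)⁻¹ * B := by
        rw [← mul_assoc]
        congr 1
        nth_rw 1 [← Real.mul_self_sqrt hh'.le]
        have := (Real.sqrt_pos.2 hh').ne'
        field_simp
  have hbound : ‖∫ t in (0:ℝ)..1, taylorWithinEval f n (Icc a b) x (x + h * t) * q t‖ ≤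
      ∫ t in (0:ℝ)..1, (|f (x + h * t)| + |h| ^ n * (√|h| * A)) * C := by
    refine intervalIntegral.norm_integral_le_of_norm_le zero_le_one
      (Filter.Eventually.of_forall fun t ht ↦ ?_) ((hfi.add (by simp)).mul_const _)
    have ht' := Ioc_subset_Icc_self ht
    rw [norm_mul]
    refine mul_le_mul ?_ (hC t ht') (norm_nonneg _) (by positivity)
    have h1 := abs_sub_taylorWithinEval_le hab hf hx (hseg t ht')
    have h2 : |x + h * t - x| ≤ |h| := by
      rw [add_sub_cancel_left, abs_mul, abs_of_nonneg ht'.1]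
      exact mul_le_of_le_one_right (abs_nonneg _) ht'.2
    have h3 : |f (x + h * t) - taylorWithinEval f n (Icc a b) x (x + h * t)| ≤
        |h| ^ n * (√|h| * A) := h1.trans (by gcongr)
    rw [Real.norm_eq_abs]
    rw [abs_sub_comm] at h3
    linarith [abs_sub_abs_le_abs_sub (taylorWithinEval f n (Icc a b) x (x + h * t)) (f (x + h * t))]
  rw [hint, intervalIntegral.integral_mul_const, intervalIntegral.integral_add hfi (by simp),
    intervalIntegral.integral_const, sub_zero, one_smul, Real.norm_eq_abs, abs_mul, abs_mul,
    abs_pow, abs_of_nonneg (by positivity : (0:ℝ) ≤ (m.factorial : ℝ)⁻¹)] at hbound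
  calc |D m| * |h| ^ m = m.factorial * ((m.factorial : ℝ)⁻¹ * |h| ^ m * |D m|) := by
        have : (m.factorial : ℝ) ≠ 0 := by positivity
        field_simp
    _ ≤ m.factorial * (((√|h|)⁻¹ * B + |h| ^ n * (√|h| * A)) * C) := by
        refine mul_le_mul_of_nonneg_left (hbound.trans ?_) (Nat.cast_nonneg _)
        gcongr
    _ = _ := by ring

/-- Additive form of the interpolation inequality, with a free length scale `h`. -/
theorem exists_abs_iteratedDerivWithin_le_rpow {n m : ℕ} (hm : m ≤ n) :
    ∃ K : ℝ, 0 ≤ K ∧ ∀ (f : ℝ → ℝ) (a b x h : ℝ),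
      ContDiffOn ℝ (n + 1 : ℕ) f (Icc a b) → x ∈ Icc a b → 0 < h → h ≤ (b - a) / 2 →
      |iteratedDerivWithin m f (Icc a b) x| ≤
        K * (h ^ (-((m : ℝ) + 1 / 2)) * √(∫ t in a..b, f t ^ 2) +
          h ^ (((n + 1 : ℕ) : ℝ) - ((m : ℝ) + 1 / 2)) *
            √(∫ t in a..b, iteratedDerivWithin (n + 1) f (Icc a b) t ^ 2)) := by
  obtain ⟨K, hK, H⟩ := exists_abs_iteratedDerivWithin_mul_pow_le hm
  refine ⟨K, hK, fun f a b x h hf hx hh hhb ↦ ?_⟩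
  have hab : a < b := by linarith
  obtain ⟨h', hh', hxh⟩ : ∃ h', |h'| = h ∧ x + h' ∈ Icc a b := by
    rcases le_total x ((a + b) / 2) with hxm | hxm
    · exact ⟨h, abs_of_pos hh, by linarith [hx.1], by linarith⟩
    · exact ⟨-h, by rw [abs_neg, abs_of_pos hh], by linarith, by linarith [hx.2]⟩
  have key := H f a b x h' hab hf hx hxh (abs_pos.1 (hh' ▸ hh))
  rw [hh'] at key
  have e1 : h ^ (-((m : ℝ) + 1 / 2)) = (h ^ m)⁻¹ * (√h)⁻¹ := by
    rw [Real.rpow_neg hh.le, Real.rpow_add hh, Real.rpow_natCast, ← Real.sqrt_eq_rpow, mul_inv]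
  have e2 : h ^ (((n + 1 : ℕ) : ℝ) - ((m : ℝ) + 1 / 2)) = (h ^ m)⁻¹ * (h ^ n * √h) := by
    rw [sub_eq_add_neg, Real.rpow_add hh, e1, Real.rpow_natCast, pow_succ]
    nth_rw 2 [← Real.mul_self_sqrt hh.le]
    have := (Real.sqrt_pos.2 hh).ne'
    field_simp
  rw [e1, e2]
  calc _ = (h ^ m)⁻¹ * (|iteratedDerivWithin m f (Icc a b) x| * h ^ m) := by
        field_simp
    _ ≤ _ := mul_le_mul_of_nonneg_left key (by positivity)
    _ = _ := by ring

/-- Optimizing an additive interpolation inequality over the scale `h ∈ (0, r]`. -/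
theorem le_rpow_mul_rpow_of_forall_le {M K A B r α β : ℝ} (hK : 0 ≤ K) (hA : 0 ≤ A) (hB : 0 ≤ B)
    (hr : 0 < r) (hα : 0 < α) (hαβ : α < β)
    (H : ∀ h, 0 < h → h ≤ r → M ≤ K * (h ^ (-α) * B + h ^ (β - α) * A)) :
    M ≤ 2 * K * A ^ (α / β) * B ^ (1 - α / β) + 2 * K * r ^ (-α) * B := by
  have hβ : 0 < β := hα.trans hαβ
  rcases hB.eq_or_lt with rfl | hBpos
  · have hlim : Filter.Tendsto (fun h : ℝ ↦ K * (h ^ (β - α) * A)) (nhdsWithin 0 (Ioi 0))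
        (nhds (K * ((0:ℝ) ^ (β - α) * A))) :=
      (((Real.continuousAt_rpow_const 0 (β - α) (Or.inr (by linarith))).tendsto.mul_const A).const_mul
        K).mono_left nhdsWithin_le_nhds
    have hM : M ≤ K * ((0:ℝ) ^ (β - α) * A) := by
      refine ge_of_tendsto hlim ?_
      filter_upwards [Ioc_mem_nhdsGT hr] with h hh
      simpa using H h hh.1 hh.2
    rw [Real.zero_rpow (by linarith)] at hM
    refine (hM.trans_eq (by ring)).trans (by positivity : (0:ℝ) ≤ _)
  by_cases hAB : A * r ^ β ≤ B
  · have h1 := H r hr le_rfl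
    have h2 : r ^ (β - α) * A ≤ r ^ (-α) * B := by
      rw [sub_eq_neg_add, Real.rpow_add hr, mul_assoc, mul_comm _ A]
      gcongr
    calc M ≤ K * (r ^ (-α) * B + r ^ (-α) * B) := h1.trans (by gcongr)
      _ = 0 + 2 * K * r ^ (-α) * B := by ring
      _ ≤ _ := by gcongr; positivity
  · push Not at hAB
    have hApos : 0 < A := by
      refine hA.lt_of_ne fun h0 ↦ ?_
      rw [← h0, zero_mul] at hAB
      exact hAB.not_ge hB
    have hBA : 0 < B / A := div_pos hBpos hApos
    have h1 := H ((B / A) ^ (1 / β)) (by positivity) (by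
      calc (B / A) ^ (1 / β) ≤ (r ^ β) ^ (1 / β) := by
            gcongr
            rw [div_le_iff₀ hApos]
            linarith
        _ = r := by rw [← Real.rpow_mul hr.le, mul_one_div_cancel hβ.ne', Real.rpow_one])
    have e1 : ((B / A) ^ (1 / β)) ^ (-α) * B = A ^ (α / β) * B ^ (1 - α / β) := by
      rw [← Real.rpow_mul hBA.le, Real.div_rpow hB hA, Real.rpow_sub hBpos, Real.rpow_one,
        show 1 / β * -α = -(α / β) by ring, Real.rpow_neg hB, Real.rpow_neg hA]
      field_simp
    have e2 : ((B / A) ^ (1 / β)) ^ (β - α) * A = A ^ (α / β) * B ^ (1 - α / β) := by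
      rw [← Real.rpow_mul hBA.le, Real.div_rpow hB hA,
        show 1 / β * (β - α) = 1 - α / β by field_simp, Real.rpow_sub hApos, Real.rpow_one]
      field_simp
    rw [e1, e2] at h1
    calc M ≤ 2 * K * A ^ (α / β) * B ^ (1 - α / β) + 0 := h1.trans_eq (by ring)
      _ ≤ _ := by gcongr; positivity

/-- Gagliardo–Nirenberg type interpolation inequality (2.1) on the interval `(0,R)`,
case `p = ∞`.  The constant `c` depends only on `R` and `l`. -/
theorem interpolation_inequality_sup (R : ℝ) (hR : 0 < R) (l : ℕ) (hl : 1 ≤ l) :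
    ∃ c : ℝ, 0 < c ∧ ∀ m : ℕ, m < l →
      ∀ φ : ℝ → ℝ, ContDiffOn ℝ l φ (Icc 0 R) →
        (⨆ x ∈ Icc (0:ℝ) R, |iteratedDerivWithin m φ (Icc 0 R) x|) ≤
          c * (∫ x in (0:ℝ)..R, (iteratedDerivWithin l φ (Icc 0 R) x) ^ 2) ^
                ((2 * (m : ℝ) + 1) / (4 * (l : ℝ))) *
              (∫ x in (0:ℝ)..R, (φ x) ^ 2) ^
                ((1 - 2 * ((2 * (m : ℝ) + 1) / (4 * (l : ℝ)))) / 2) +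
            c * (∫ x in (0:ℝ)..R, (φ x) ^ 2) ^ ((1 : ℝ) / 2) := by
  obtain ⟨n, rfl⟩ : ∃ n, l = n + 1 := ⟨l - 1, by omega⟩
  have hK : ∀ m : Fin (n + 1), _ := fun m ↦
    exists_abs_iteratedDerivWithin_le_rpow (Nat.le_of_lt_succ m.2)
  choose K hK0 hK using hK
  let c : Fin (n + 1) → ℝ := fun m ↦
    2 * K m + 2 * K m * (R / 2) ^ (-(((m : ℕ) : ℝ) + 1 / 2))
  have hc : ∀ m, 0 ≤ c m := fun m ↦ by have := hK0 m; positivity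
  refine ⟨1 + ∑ m, c m, by have := Finset.univ.sum_nonneg fun m _ ↦ hc m; positivity,
    fun m hm φ hφ ↦ ?_⟩
  have hI : 0 ≤ ∫ x in (0:ℝ)..R, (iteratedDerivWithin (n + 1) φ (Icc 0 R) x) ^ 2 :=
    intervalIntegral.integral_nonneg hR.le fun _ _ ↦ sq_nonneg _
  have hJ : 0 ≤ ∫ x in (0:ℝ)..R, φ x ^ 2 :=
    intervalIntegral.integral_nonneg hR.le fun _ _ ↦ sq_nonneg _
  have hK0m := hK0 ⟨m, hm⟩
  have hcle : c ⟨m, hm⟩ ≤ 1 + ∑ m, c m := by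
    linarith [Finset.single_le_sum (fun m _ ↦ hc m) (Finset.mem_univ (⟨m, hm⟩ : Fin (n + 1)))]
  have hc0 : 0 ≤ 1 + ∑ m, c m := (hc _).trans hcle
  have hpos : 0 ≤ 2 * K ⟨m, hm⟩ * (R / 2) ^ (-((m : ℝ) + 1 / 2)) := by positivity
  refine Real.iSup_le (fun x ↦ Real.iSup_le (fun hx ↦ ?_) (by positivity)) (by positivity)
  have hmn : (m : ℝ) + 1 ≤ ((n + 1 : ℕ) : ℝ) := by exact_mod_cast hm
  refine (le_rpow_mul_rpow_of_forall_le (hK0 ⟨m, hm⟩) (Real.sqrt_nonneg _) (Real.sqrt_nonneg _)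
    (half_pos hR) (by positivity : 0 < (m : ℝ) + 1 / 2) (by linarith)
    fun h hh hhR ↦ hK ⟨m, hm⟩ φ 0 R x h hφ hx hh (by simpa using hhR)).trans ?_
  rw [Real.sqrt_eq_rpow, Real.sqrt_eq_rpow, ← Real.rpow_mul hI, ← Real.rpow_mul hJ,
    show 1 / 2 * (((m : ℝ) + 1 / 2) / ((n + 1 : ℕ) : ℝ)) =
      (2 * (m : ℝ) + 1) / (4 * ((n + 1 : ℕ) : ℝ)) by field_simp; ring,
    show 1 / 2 * (1 - ((m : ℝ) + 1 / 2) / ((n + 1 : ℕ) : ℝ)) =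
      (1 - 2 * ((2 * (m : ℝ) + 1) / (4 * ((n + 1 : ℕ) : ℝ)))) / 2 by field_simp; ring]
  have h1 : 2 * K ⟨m, hm⟩ ≤ 1 + ∑ m, c m := (le_add_of_nonneg_right hpos).trans hcle
  have h2 : 2 * K ⟨m, hm⟩ * (R / 2) ^ (-((m : ℝ) + 1 / 2)) ≤ 1 + ∑ m, c m :=
    (le_add_of_nonneg_left (by positivity)).trans hcle
  gcongr
end

section
/- Let l ≥ 1 be an integer, R, T > 0, and let a, b be real constants with a > 0 and b ≤ 0. Let f, G₀, …, G_l : [0,T] × [0,R] → ℝ be smooth, and let u : [0,T] × [0,R] → ℝ be smooth and satisfy the equation ∂_t u − (−1)^l ( a ∂_x^{2l+1} u + b ∂_x^{2l} u ) = f + Σ_{j=0}^{l} (−1)^j ∂_x^j G_j on [0,T] × [0,R], together with u(0,x) = 0 for all x ∈ [0,R], ∂_x^j u(t,0) = 0 for j = 0,…,l−1 and ∂_x^j u(t,R) = 0 for j = 0,…,l, for all t ∈ [0,T]. Then with ρ(x) = 1 + x, for every t ∈ [0,T] one has ∫₀^R u(t,x)² ρ(x) dx + ∫₀^t ∫₀^R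 ( (2l+1)a − 2bρ(x) ) (∂_x^l u(τ,x))² dx dτ ≤ 2 ∫₀^t ∫₀^R f u ρ dx dτ + 2 Σ_{j=0}^{l} ∫₀^t ∫₀^R G_j ( ∂_x^j u · ρ + j ∂_x^{j−1} u ) dx dτ (the term j ∂_x^{j−1} u being absent for j = 0). -/
open MeasureTheory Set

lemma ContDiff.iteratedDeriv_infty {v : ℝ → ℝ} (hv : ContDiff ℝ (⊤ : ℕ∞) v) (n : ℕ) :
    ContDiff ℝ (⊤ : ℕ∞) (iteratedDeriv n v) := by
  rw [iteratedDeriv_eq_iterate]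
  exact ContDiff.iterate_deriv n hv

lemma ContDiff.hasDerivAt_iteratedDeriv {v : ℝ → ℝ} (hv : ContDiff ℝ (⊤ : ℕ∞) v) (n : ℕ) (x : ℝ) :
    HasDerivAt (iteratedDeriv n v) (iteratedDeriv (n + 1) v x) x := by
  rw [iteratedDeriv_succ]
  exact ((hv.iteratedDeriv_infty n).differentiable (by simp) x).hasDerivAt

lemma iteratedDeriv_add_index (m n : ℕ) (v : ℝ → ℝ) :
    iteratedDeriv (m + n) v = iteratedDeriv m (iteratedDeriv n v) := by
  simp only [iteratedDeriv_eq_iterate, Function.iterate_add_apply]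

/-- The partial derivatives in the second variable of a jointly smooth function are jointly
smooth. -/
lemma ContDiff.iteratedDeriv_snd {F : ℝ → ℝ → ℝ}
    (hF : ContDiff ℝ (⊤ : ℕ∞) fun p : ℝ × ℝ => F p.1 p.2) (n : ℕ) :
    ContDiff ℝ (⊤ : ℕ∞) fun p : ℝ × ℝ => iteratedDeriv n (F p.1) p.2 := by
  induction n with
  | zero => simpa using hF
  | succ n ih =>
    have h : (fun p : ℝ × ℝ => iteratedDeriv (n + 1) (F p.1) p.2) =
        fun p => fderiv ℝ (fun q : ℝ × ℝ => iteratedDeriv n (F q.1) q.2) p ((0 : ℝ), (1 : ℝ)) := by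
      ext p
      rw [iteratedDeriv_succ]
      have h1 := (ih.differentiable (by simp) (p.1, p.2)).hasFDerivAt.comp_hasDerivAt p.2
        ((hasDerivAt_const p.2 p.1).prodMk (hasDerivAt_id p.2))
      exact h1.deriv
    rw [h]
    exact (ih.fderiv_right (by simp)).clm_apply contDiff_const

lemma ContDiff.continuous_deriv_fst {F : ℝ → ℝ → ℝ}
    (hF : ContDiff ℝ (⊤ : ℕ∞) fun p : ℝ × ℝ => F p.1 p.2) :
    Continuous fun p : ℝ × ℝ => deriv (fun s => F s p.2) p.1 := by
  have h : (fun p : ℝ × ℝ => deriv (fun s => F s p.2) p.1) =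
      fun p => fderiv ℝ (fun q : ℝ × ℝ => F q.1 q.2) p ((1 : ℝ), (0 : ℝ)) := by
    ext p
    have h1 := (hF.differentiable (by simp) (p.1, p.2)).hasFDerivAt.comp_hasDerivAt p.1
      ((hasDerivAt_id p.1).prodMk (hasDerivAt_const p.1 p.2))
    exact h1.deriv
  rw [h]
  exact (hF.continuous_fderiv (by simp)).clm_apply continuous_const

/-- Repeated integration by parts with vanishing boundary terms. -/
lemma integral_iteratedDeriv_mul {g : ℝ → ℝ} (hg : ContDiff ℝ (⊤ : ℕ∞) g) {p q : ℝ} (n : ℕ)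
    {w : ℝ → ℝ} (hw : ContDiff ℝ (⊤ : ℕ∞) w)
    (hp : ∀ i < n, iteratedDeriv i w p = 0) (hq : ∀ i < n, iteratedDeriv i w q = 0) :
    ∫ x in p..q, iteratedDeriv n g x * w x =
      (-1 : ℝ) ^ n * ∫ x in p..q, g x * iteratedDeriv n w x := by
  induction n generalizing w with
  | zero => simp
  | succ n ih =>
    have hw' : ContDiff ℝ (⊤ : ℕ∞) (deriv w) := by simpa using hw.iteratedDeriv_infty 1
    have hwp : w p = 0 := by simpa using hp 0 (by lia)
    have hwq : w q = 0 := by simpa using hq 0 (by lia)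
    have hparts := intervalIntegral.integral_mul_deriv_eq_deriv_mul (a := p) (b := q)
      (u := w) (v := iteratedDeriv n g)
      (fun x _ => (hw.differentiable (by simp) x).hasDerivAt)
      (fun x _ => hg.hasDerivAt_iteratedDeriv n x)
      (hw'.continuous.intervalIntegrable _ _)
      ((hg.iteratedDeriv_infty (n + 1)).continuous.intervalIntegrable _ _)
    have hstep := ih hw'
      (fun i hi => by rw [← iteratedDeriv_succ']; exact hp (i + 1) (by lia))
      (fun i hi => by rw [← iteratedDeriv_succ']; exact hq (i + 1) (by lia))
    rw [iteratedDeriv_succ' (f := w), pow_succ, mul_neg_one, neg_mul, ← hstep]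
    simp only [mul_comm (iteratedDeriv _ g _)]
    rw [hparts, hwp, hwq]
    ring

lemma iteratedDeriv_mul_one_add {v : ℝ → ℝ} (hv : ContDiff ℝ (⊤ : ℕ∞) v) (n : ℕ) :
    iteratedDeriv n (fun x => v x * (1 + x)) =
      fun x => iteratedDeriv n v x * (1 + x) + (n : ℝ) * iteratedDeriv (n - 1) v x := by
  induction n with
  | zero => simp
  | succ n ih =>
    rw [iteratedDeriv_succ, ih]
    ext x
    have h1 := (hv.hasDerivAt_iteratedDeriv n x).mul ((hasDerivAt_id x).const_add 1)
    rcases n with _ | n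
    · simpa [Pi.mul_def] using h1.deriv
    · have h2 := h1.add ((hv.hasDerivAt_iteratedDeriv n x).const_mul ((n + 1 : ℕ) : ℝ))
      refine h2.deriv.trans ?_
      simp only [id_eq, Nat.add_sub_cancel]
      push_cast
      ring

/-- Testing the even-order term against `v (1 + x)`. -/
lemma integral_even_order_mul_weight {v : ℝ → ℝ} (hv : ContDiff ℝ (⊤ : ℕ∞) v) {l : ℕ} (hl : 1 ≤ l)
    {R : ℝ} (h0 : ∀ j < l, iteratedDeriv j v 0 = 0) (hR : ∀ j < l, iteratedDeriv j v R = 0) :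
    (-1 : ℝ) ^ l * ∫ x in (0:ℝ)..R, iteratedDeriv (2 * l) v x * (v x * (1 + x)) =
      ∫ x in (0:ℝ)..R, iteratedDeriv l v x ^ 2 * (1 + x) := by
  obtain ⟨k, rfl⟩ : ∃ k, l = k + 1 := ⟨l - 1, by lia⟩
  have hP := (hv.iteratedDeriv_infty (k + 1)).continuous
  have hQ := (hv.iteratedDeriv_infty k).continuous
  have hw : ContDiff ℝ (⊤ : ℕ∞) fun x => v x * (1 + x) := by fun_prop
  have hparts := integral_iteratedDeriv_mul (hv.iteratedDeriv_infty (k + 1)) (p := 0) (q := R)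
    (k + 1) hw
    (fun i hi => by
      simp [iteratedDeriv_mul_one_add hv, h0 i hi, h0 (i - 1) (by lia)])
    (fun i hi => by
      simp [iteratedDeriv_mul_one_add hv, hR i hi, hR (i - 1) (by lia)])
  have hftc := intervalIntegral.integral_eq_sub_of_hasDerivAt (a := 0) (b := R)
    (fun x _ => ((hv.hasDerivAt_iteratedDeriv k x).pow 2).const_mul (((k + 1 : ℕ) : ℝ) / 2))
    (Continuous.intervalIntegrable (by fun_prop) _ _)
  rw [two_mul, iteratedDeriv_add_index, hparts, ← mul_assoc, ← pow_add, ← two_mul, pow_mul,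
    neg_one_sq, one_pow, one_mul, iteratedDeriv_mul_one_add hv, ← sub_eq_zero,
    ← intervalIntegral.integral_sub (Continuous.intervalIntegrable (by fun_prop) _ _)
      (Continuous.intervalIntegrable (by fun_prop) _ _)]
  simp only [Pi.pow_apply, h0 k (by lia), hR k (by lia)] at hftc
  rw [sub_eq_zero.mpr (by simp)] at hftc
  rw [← hftc]
  congr 1
  ext x
  simp only [Nat.add_sub_cancel]
  push_cast
  ring

/-- Testing the odd-order term against `v (1 + x)`. -/
lemma integral_odd_order_mul_weight {v : ℝ → ℝ} (hv : ContDiff ℝ (⊤ : ℕ∞) v) {l : ℕ} (hl : 1 ≤ l)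
    {R : ℝ} (h0 : ∀ j < l, iteratedDeriv j v 0 = 0) (hR : ∀ j ≤ l, iteratedDeriv j v R = 0) :
    (-1 : ℝ) ^ l * ∫ x in (0:ℝ)..R, iteratedDeriv (2 * l + 1) v x * (v x * (1 + x)) =
      -((l : ℝ) + 1 / 2) * (∫ x in (0:ℝ)..R, iteratedDeriv l v x ^ 2) -
        iteratedDeriv l v 0 ^ 2 / 2 := by
  obtain ⟨k, rfl⟩ : ∃ k, l = k + 1 := ⟨l - 1, by lia⟩
  have hS := (hv.iteratedDeriv_infty (k + 1 + 1)).continuous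
  have hP := (hv.iteratedDeriv_infty (k + 1)).continuous
  have hQ := (hv.iteratedDeriv_infty k).continuous
  have hw : ContDiff ℝ (⊤ : ℕ∞) fun x => v x * (1 + x) := by fun_prop
  have hparts := integral_iteratedDeriv_mul (hv.iteratedDeriv_infty (k + 1 + 1)) (p := 0) (q := R)
    (k + 1) hw
    (fun i hi => by
      simp [iteratedDeriv_mul_one_add hv, h0 i hi, h0 (i - 1) (by lia)])
    (fun i hi => by
      simp [iteratedDeriv_mul_one_add hv, hR i hi.le, hR (i - 1) (by lia)])
  have hftc := intervalIntegral.integral_eq_sub_of_hasDerivAt (a := 0) (b := R)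
    (fun x _ => ((((hv.hasDerivAt_iteratedDeriv (k + 1) x).pow 2).mul
      ((hasDerivAt_id x).const_add 1)).const_mul (1 / 2 : ℝ)).add
      (((hv.hasDerivAt_iteratedDeriv (k + 1) x).mul
        (hv.hasDerivAt_iteratedDeriv k x)).const_mul ((k + 1 : ℕ) : ℝ)))
    (Continuous.intervalIntegrable (by simp only [id_eq, Pi.pow_apply]; fun_prop) _ _)
  rw [show 2 * (k + 1) + 1 = (k + 1) + (k + 1 + 1) by ring, iteratedDeriv_add_index, hparts,
    ← mul_assoc, ← pow_add, ← two_mul, pow_mul, neg_one_sq, one_pow, one_mul,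
    iteratedDeriv_mul_one_add hv, neg_mul, ← intervalIntegral.integral_const_mul,
    neg_sub_left, eq_neg_iff_add_eq_zero, ← add_assoc, add_right_comm,
    ← intervalIntegral.integral_add (Continuous.intervalIntegrable (by fun_prop) _ _)
      (Continuous.intervalIntegrable (by fun_prop) _ _)]
  simp only [Pi.add_apply, Pi.mul_apply, Pi.pow_apply, id_eq, h0 k (by lia), hR k (by lia),
    hR (k + 1) le_rfl] at hftc
  have h : ∫ x in (0:ℝ)..R, (iteratedDeriv (k + 1 + 1) v x *
        (iteratedDeriv (k + 1) v x * (1 + x) +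
          ((k + 1 : ℕ) : ℝ) * iteratedDeriv (k + 1 - 1) v x) +
        (((k + 1 : ℕ) : ℝ) + 1 / 2) * iteratedDeriv (k + 1) v x ^ 2) =
      -(iteratedDeriv (k + 1) v 0 ^ 2 / 2) := by
    refine Eq.trans ?_ (hftc.trans ?_)
    · congr 1
      ext x
      simp only [Nat.add_sub_cancel]
      push_cast
      ring
    · ring
  linarith

/-- The energy balance at a fixed time, with `v'` in the role of the time derivative. -/
lemma weighted_energy_balance {l : ℕ} (hl : 1 ≤ l) {R : ℝ} (hRpos : 0 < R) (a b : ℝ)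
    {v v' f : ℝ → ℝ} {G : ℕ → ℝ → ℝ} (hv : ContDiff ℝ (⊤ : ℕ∞) v)
    (hf : Continuous f) (hG : ∀ j ≤ l, ContDiff ℝ (⊤ : ℕ∞) (G j))
    (heq : ∀ x ∈ Icc (0:ℝ) R,
      v' x - (-1 : ℝ) ^ l * (a * iteratedDeriv (2 * l + 1) v x + b * iteratedDeriv (2 * l) v x) =
        f x + ∑ j ∈ Finset.range (l + 1), (-1 : ℝ) ^ j * iteratedDeriv j (G j) x)
    (h0 : ∀ j < l, iteratedDeriv j v 0 = 0) (hR : ∀ j ≤ l, iteratedDeriv j v R = 0) :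
    (∫ x in (0:ℝ)..R, 2 * v x * v' x * (1 + x)) +
        (∫ x in (0:ℝ)..R,
          ((2 * (l : ℝ) + 1) * a - 2 * b * (1 + x)) * (iteratedDeriv l v x) ^ 2) +
        a * iteratedDeriv l v 0 ^ 2 =
      2 * (∫ x in (0:ℝ)..R, f x * v x * (1 + x)) +
        2 * ∑ j ∈ Finset.range (l + 1), ∫ x in (0:ℝ)..R,
          G j x * (iteratedDeriv j v x * (1 + x) + (j : ℝ) * iteratedDeriv (j - 1) v x) := by
  have hw : ContDiff ℝ (⊤ : ℕ∞) fun x => v x * (1 + x) := by fun_prop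
  have hvc := hv.continuous
  have hD (n : ℕ) := (hv.iteratedDeriv_infty n).continuous
  have hGparts : ∀ j ∈ Finset.range (l + 1),
      ∫ x in (0:ℝ)..R, (-1 : ℝ) ^ j * iteratedDeriv j (G j) x * (v x * (1 + x)) =
      ∫ x in (0:ℝ)..R,
        G j x * (iteratedDeriv j v x * (1 + x) + (j : ℝ) * iteratedDeriv (j - 1) v x) := by
    intro j hj
    have hjl : j ≤ l := by simpa [Nat.lt_succ_iff] using hj
    simp only [mul_assoc ((-1 : ℝ) ^ j)]
    rw [intervalIntegral.integral_const_mul, integral_iteratedDeriv_mul (hG j hjl) j hw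
      (fun i hi => by
        simp [iteratedDeriv_mul_one_add hv, h0 i (by lia), h0 (i - 1) (by lia)])
      (fun i hi => by
        simp [iteratedDeriv_mul_one_add hv, hR i (by lia), hR (i - 1) (by lia)]),
      ← mul_assoc, ← pow_add, ← two_mul, pow_mul, neg_one_sq, one_pow, one_mul,
      iteratedDeriv_mul_one_add hv]
  have hGint : ∀ j ∈ Finset.range (l + 1), IntervalIntegrable
      (fun x => (-1 : ℝ) ^ j * iteratedDeriv j (G j) x * (v x * (1 + x))) volume 0 R := by
    intro j hj
    have := ((hG j (by simpa [Nat.lt_succ_iff] using hj)).iteratedDeriv_infty j).continuous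
    exact Continuous.intervalIntegrable (by fun_prop) _ _
  have hsplit : ∫ x in (0:ℝ)..R, 2 * v x * v' x * (1 + x) =
      ∫ x in (0:ℝ)..R, (2 * (f x * v x * (1 + x)) +
        2 * (∑ j ∈ Finset.range (l + 1),
          (-1 : ℝ) ^ j * iteratedDeriv j (G j) x * (v x * (1 + x))) +
        (2 * a * (-1 : ℝ) ^ l * (iteratedDeriv (2 * l + 1) v x * (v x * (1 + x))) +
        2 * b * (-1 : ℝ) ^ l * (iteratedDeriv (2 * l) v x * (v x * (1 + x))))) := by
    refine intervalIntegral.integral_congr fun x hx => ?_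
    rw [uIcc_of_le hRpos.le] at hx
    have h := heq x hx
    rw [sub_eq_iff_eq_add] at h
    simp only [h, ← Finset.sum_mul]
    ring
  have hdiss : ∫ x in (0:ℝ)..R,
      ((2 * (l : ℝ) + 1) * a - 2 * b * (1 + x)) * (iteratedDeriv l v x) ^ 2 =
      (2 * (l : ℝ) + 1) * a * (∫ x in (0:ℝ)..R, iteratedDeriv l v x ^ 2) -
        2 * b * ∫ x in (0:ℝ)..R, iteratedDeriv l v x ^ 2 * (1 + x) := by
    rw [← intervalIntegral.integral_const_mul, ← intervalIntegral.integral_const_mul,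
      ← intervalIntegral.integral_sub (Continuous.intervalIntegrable (by fun_prop) _ _)
        (Continuous.intervalIntegrable (by fun_prop) _ _)]
    congr 1
    ext x
    ring
  have hsum : IntervalIntegrable (fun x => ∑ j ∈ Finset.range (l + 1),
      (-1 : ℝ) ^ j * iteratedDeriv j (G j) x * (v x * (1 + x))) volume 0 R := by
    simpa only [Finset.sum_fn] using IntervalIntegrable.sum (Finset.range (l + 1)) hGint
  have hI₁ : IntervalIntegrable (fun x => 2 * (f x * v x * (1 + x))) volume 0 R :=
    Continuous.intervalIntegrable (by fun_prop) _ _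
  have hI₂ : IntervalIntegrable (fun x => 2 * a * (-1 : ℝ) ^ l *
      (iteratedDeriv (2 * l + 1) v x * (v x * (1 + x)))) volume 0 R :=
    Continuous.intervalIntegrable (by fun_prop) _ _
  have hI₃ : IntervalIntegrable (fun x => 2 * b * (-1 : ℝ) ^ l *
      (iteratedDeriv (2 * l) v x * (v x * (1 + x)))) volume 0 R :=
    Continuous.intervalIntegrable (by fun_prop) _ _
  rw [hsplit, hdiss, intervalIntegral.integral_add (hI₁.add (hsum.const_mul 2))
      (hI₂.add hI₃), intervalIntegral.integral_add hI₁ (hsum.const_mul 2),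
    intervalIntegral.integral_add hI₂ hI₃]
  simp only [intervalIntegral.integral_const_mul]
  rw [intervalIntegral.integral_finsetSum hGint, Finset.sum_congr rfl hGparts]
  have hodd := integral_odd_order_mul_weight hv hl h0 hR
  have heven := integral_even_order_mul_weight hv hl h0 fun j hj => hR j hj.le
  linear_combination 2 * a * hodd + 2 * b * heven

/-- The weighted energy is the time integral of its formal derivative. -/
lemma weighted_energy_eq_integral {u : ℝ → ℝ → ℝ}
    (hu : ContDiff ℝ (⊤ : ℕ∞) fun p : ℝ × ℝ => u p.1 p.2) {R : ℝ} (hR : 0 ≤ R)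
    (hinit : ∀ x ∈ Icc (0:ℝ) R, u 0 x = 0) (t : ℝ) :
    ∫ x in (0:ℝ)..R, (u t x) ^ 2 * (1 + x) =
      ∫ τ in (0:ℝ)..t, ∫ x in (0:ℝ)..R, 2 * u τ x * deriv (fun s => u s x) τ * (1 + x) := by
  have hd := hu.continuous_deriv_fst
  have hc := hu.continuous
  have hcont : Continuous fun p : ℝ × ℝ =>
      2 * u p.1 p.2 * deriv (fun s => u s p.2) p.1 * (1 + p.2) := by fun_prop
  rw [intervalIntegral_intervalIntegral_swap]
  · refine intervalIntegral.integral_congr fun x hx => ?_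
    rw [uIcc_of_le hR] at hx
    have hux : Differentiable ℝ fun s => u s x :=
      (hu.comp (contDiff_id.prodMk contDiff_const)).differentiable (by simp)
    have hftc := intervalIntegral.integral_eq_sub_of_hasDerivAt (a := 0) (b := t)
      (f := fun s => u s x ^ 2 * (1 + x))
      (f' := fun s => 2 * u s x * deriv (fun s => u s x) s * (1 + x))
      (fun s _ => by
        have := ((hux s).hasDerivAt.pow 2).mul_const (1 + x)
        simpa using this)
      ((hcont.comp (Continuous.prodMk_left x)).intervalIntegrable _ _)
    simp only [hftc, hinit x hx]
    ring
  · exact (hcont.continuousOn.integrableOn_compact (isCompact_uIcc.prod isCompact_uIcc)).mono_set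
      (Set.prod_mono uIoc_subset_uIcc uIoc_subset_uIcc)

/-- The energy inequality (2.7) of the paper for smooth classical solutions of the
constant-coefficient linear equation with zero initial and boundary data. -/
theorem energy_inequality (l : ℕ) (hl : 1 ≤ l) (R T : ℝ) (hR : 0 < R) (hT : 0 < T)
    (a b : ℝ) (ha : 0 < a) (hb : b ≤ 0)
    (f : ℝ → ℝ → ℝ) (G : ℕ → ℝ → ℝ → ℝ) (u : ℝ → ℝ → ℝ)
    (hf : ContDiff ℝ (⊤ : ℕ∞) fun p : ℝ × ℝ => f p.1 p.2)
    (hG : ∀ j ≤ l, ContDiff ℝ (⊤ : ℕ∞) fun p : ℝ × ℝ => G j p.1 p.2)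
    (hu : ContDiff ℝ (⊤ : ℕ∞) fun p : ℝ × ℝ => u p.1 p.2)
    (heq : ∀ t ∈ Icc (0:ℝ) T, ∀ x ∈ Icc (0:ℝ) R,
      deriv (fun s => u s x) t -
          (-1 : ℝ) ^ l * (a * iteratedDeriv (2 * l + 1) (u t) x +
            b * iteratedDeriv (2 * l) (u t) x) =
        f t x + ∑ j ∈ Finset.range (l + 1), (-1 : ℝ) ^ j * iteratedDeriv j (G j t) x)
    (hinit : ∀ x ∈ Icc (0:ℝ) R, u 0 x = 0)
    (hbc0 : ∀ t ∈ Icc (0:ℝ) T, ∀ j < l, iteratedDeriv j (u t) 0 = 0)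
    (hbcR : ∀ t ∈ Icc (0:ℝ) T, ∀ j ≤ l, iteratedDeriv j (u t) R = 0) :
    ∀ t ∈ Icc (0:ℝ) T,
      (∫ x in (0:ℝ)..R, (u t x) ^ 2 * (1 + x)) +
        (∫ τ in (0:ℝ)..t, ∫ x in (0:ℝ)..R,
          ((2 * (l : ℝ) + 1) * a - 2 * b * (1 + x)) * (iteratedDeriv l (u τ) x) ^ 2) ≤
      2 * (∫ τ in (0:ℝ)..t, ∫ x in (0:ℝ)..R, f τ x * u τ x * (1 + x)) +
        2 * ∑ j ∈ Finset.range (l + 1), ∫ τ in (0:ℝ)..t, ∫ x in (0:ℝ)..R,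
          G j τ x * (iteratedDeriv j (u τ) x * (1 + x) +
            (j : ℝ) * iteratedDeriv (j - 1) (u τ) x) := by
  intro t ht
  have hD (n : ℕ) : Continuous fun p : ℝ × ℝ => iteratedDeriv n (u p.1) p.2 :=
    (hu.iteratedDeriv_snd n).continuous
  have huc := hu.continuous
  have hut := hu.continuous_deriv_fst
  have hfc := hf.continuous
  have hparam {F : ℝ → ℝ → ℝ} (hF : Continuous fun p : ℝ × ℝ => F p.1 p.2) :
      IntervalIntegrable (fun τ => ∫ x in (0:ℝ)..R, F τ x) volume 0 t :=
    (intervalIntegral.continuous_parametric_intervalIntegral_of_continuous' hF 0 R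
      ).intervalIntegrable _ _
  have hI₁ := hparam (F := fun τ x => 2 * u τ x * deriv (fun s => u s x) τ * (1 + x))
    (by fun_prop)
  have hI₂ := hparam (F := fun τ x =>
    ((2 * (l : ℝ) + 1) * a - 2 * b * (1 + x)) * (iteratedDeriv l (u τ) x) ^ 2) (by fun_prop)
  have hI₃ := hparam (F := fun τ x => f τ x * u τ x * (1 + x)) (by fun_prop)
  have hI₄ : ∀ j ∈ Finset.range (l + 1), IntervalIntegrable (fun τ => ∫ x in (0:ℝ)..R,
      G j τ x * (iteratedDeriv j (u τ) x * (1 + x) +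
        (j : ℝ) * iteratedDeriv (j - 1) (u τ) x)) volume 0 t := by
    intro j hj
    have := (hG j (by simpa [Nat.lt_succ_iff] using hj)).continuous
    exact hparam (by fun_prop)
  have hI₅ : IntervalIntegrable (fun τ => ∑ j ∈ Finset.range (l + 1), ∫ x in (0:ℝ)..R,
      G j τ x * (iteratedDeriv j (u τ) x * (1 + x) +
        (j : ℝ) * iteratedDeriv (j - 1) (u τ) x)) volume 0 t := by
    simpa only [Finset.sum_fn] using IntervalIntegrable.sum (Finset.range (l + 1)) hI₄
  rw [weighted_energy_eq_integral hu hR.le hinit, ← intervalIntegral.integral_add hI₁ hI₂,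
    ← intervalIntegral.integral_finsetSum hI₄, ← intervalIntegral.integral_const_mul,
    ← intervalIntegral.integral_const_mul,
    ← intervalIntegral.integral_add (hI₃.const_mul 2) (hI₅.const_mul 2)]
  refine intervalIntegral.integral_mono_on ht.1 (hI₁.add hI₂)
    ((hI₃.const_mul 2).add (hI₅.const_mul 2)) fun τ hτ => ?_
  have hτT : τ ∈ Icc (0:ℝ) T := ⟨hτ.1, hτ.2.trans ht.2⟩
  have hslice {F : ℝ → ℝ → ℝ} (hF : ContDiff ℝ (⊤ : ℕ∞) fun p : ℝ × ℝ => F p.1 p.2) :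
      ContDiff ℝ (⊤ : ℕ∞) (F τ) := hF.comp (contDiff_const.prodMk contDiff_id)
  have hbal := weighted_energy_balance hl hR a b (hslice hu) (hslice hf).continuous
    (G := fun j => G j τ) (fun j hj => hslice (hG j hj)) (heq τ hτT) (hbc0 τ hτT) (hbcR τ hτT)
  rw [← hbal]
  exact le_add_of_nonneg_right (by positivity)
end
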